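/- arXiv:2003.04615 — 5 statements merged into one kernel-verified Lean document; each statement's English description precedes it below -/
import Mathlib

section
/- Assume a₀ is a positive integer whose Col₂-orbit a_α tends to infinity. Then for every positive integer ψ, setting p = ⌊log ψ / log 3⌋, the set { α ∈ ℕ : ⌊3^{p - q_α} · a_α⌋ = ψ } is infinite, where q_α = ⌊log a_α / log 3⌋. (Equivalently: every positive integer ψ occurs infinitely often as the string of leading base-3 digits of the terms of the orbit.) -/
/-- The accelerated Collatz map `Col₂`: `(3a+1)/2` if `a` odd, `a/2` if `a` even. -/
def col2 (a : ℕ) : ℕ := if a % 2 = 1 then (3 * a + 1) / 2 else a / 2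

/-- `q_α = ⌊log (a α) / log 3⌋`. -/
noncomputable def qseq (a : ℕ → ℕ) (α : ℕ) : ℤ := ⌊Real.log (a α) / Real.log 3⌋

/-- `c_α = 3^{-q_α} · a_α`. -/
noncomputable def cseq (a : ℕ → ℕ) (α : ℕ) : ℝ := (3 : ℝ) ^ (-qseq a α) * (a α)

open Filter Topology

theorem aux_irr : Irrational (Real.log 2 / Real.log 3) := by
  rintro ⟨r, hr⟩
  have h2 : 0 < Real.log 2 := Real.log_pos (by norm_num)
  have h3 : 0 < Real.log 3 := Real.log_pos (by norm_num)
  have hr0 : (0:ℝ) < r := by rw [hr]; positivity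
  have hr0' : 0 < r := by exact_mod_cast hr0
  have hn : 0 < r.num := Rat.num_pos.2 hr0'
  obtain ⟨n, hn'⟩ := Int.eq_ofNat_of_zero_le hn.le
  have hd : (0:ℝ) < r.den := by exact_mod_cast r.den_pos
  have e : (r.den : ℝ) * Real.log 2 = n * Real.log 3 := by
    rw [Rat.cast_def, hn'] at hr
    push_cast at hr
    field_simp at hr
    linarith
  rw [← Real.log_pow, ← Real.log_pow] at e
  have e2 : (2:ℝ) ^ r.den = 3 ^ n := Real.log_injOn_pos (by simp) (by simp) e
  have e3 : 2 ^ r.den = 3 ^ n := by exact_mod_cast e2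
  have h4 : Even (3 ^ n) := by
    rw [← e3]; exact (Nat.even_pow.2 ⟨even_two, r.den_pos.ne'⟩)
  have h5 : Odd (3 ^ n) := Odd.pow (by decide)
  exact (Nat.not_even_iff_odd.2 h5) h4

theorem aux_rot {G : Type*} [AddCommGroup G] [TopologicalSpace G] [IsTopologicalAddGroup G]
    [CompactSpace G] (t : G) (ht : DenseRange (fun n : ℕ => n • t))
    (x : ℕ → G) (hx : Tendsto (fun n => x (n+1) - x n) atTop (𝓝 t))
    (U : Set G) (hU : IsOpen U) (hne : U.Nonempty) : ∃ᶠ n in atTop, x n ∈ U := by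
  have hk : ∀ k : ℕ, Tendsto (fun n => x (n+k) - x n) atTop (𝓝 (k • t)) := by
    intro k
    induction k with
    | zero => simpa using (tendsto_const_nhds : Tendsto (fun _ : ℕ => (0:G)) atTop (𝓝 0))
    | succ k ih =>
      have h1 := (hx.comp (tendsto_add_atTop_nat k)).add ih
      rw [succ_nsmul, add_comm (k • t)]
      refine h1.congr fun n => ?_
      simp [add_assoc]
  obtain ⟨y, hy⟩ : ∃ y, MapClusterPt y atTop x := exists_clusterPt_of_compactSpace _
  obtain ⟨k, hkU⟩ : ∃ k : ℕ, y + k • t ∈ U := by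
    have := ht.exists_mem_open (s := (fun z => y + z) ⁻¹' U) (hU.preimage (by fun_prop))
      (by obtain ⟨u, hu⟩ := hne; exact ⟨u - y, by simpa using hu⟩)
    simpa using this
  have hc : Tendsto (fun p : G × G => p.1 + p.2) (𝓝 y ×ˢ 𝓝 (k • t)) (𝓝 (y + k • t)) := by
    rw [← nhds_prod_eq]; exact tendsto_add
  have h1 := hc (hU.mem_nhds hkU)
  rw [Filter.mem_map, Filter.mem_prod_iff] at h1
  obtain ⟨A, hA, B, hB, hAB⟩ := h1
  have h2 := ((mapClusterPt_iff_frequently.1 hy A hA).and_eventually ((hk k) hB))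
  have h3 : ∃ᶠ n in atTop, x (n + k) ∈ U := h2.mono fun n hn => by
    have := hAB (Set.mk_mem_prod hn.1 hn.2)
    simpa using this
  exact (tendsto_add_atTop_nat k).frequently h3

theorem aux_step (a : ℕ) (ha : 1 ≤ a) : ∃ k : ℤ, ∃ e : ℝ, 0 ≤ e ∧ e ≤ (1 / a : ℝ) ∧
    Real.log (col2 a) / Real.log 3 - Real.log a / Real.log 3
      = k + (-(Real.log 2 / Real.log 3) + e) := by
  have h3 : 0 < Real.log 3 := Real.log_pos (by norm_num)
  have h31 : 1 ≤ Real.log 3 := by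
    rw [Real.le_log_iff_exp_le (by norm_num)]
    linarith [Real.exp_one_lt_d9]
  have ha' : (0:ℝ) < a := by exact_mod_cast ha
  unfold col2
  split_ifs with h
  · have hc : (((3 * a + 1) / 2 : ℕ) : ℝ) = 3 / 2 * a * (1 + 1 / (3 * a)) := by
      have : 2 * ((3 * a + 1) / 2) = 3 * a + 1 := by omega
      have h' : (2:ℝ) * (((3 * a + 1) / 2 : ℕ) : ℝ) = 3 * a + 1 := by exact_mod_cast this
      field_simp
      linarith
    have hpos : (0:ℝ) ≤ 1 / (3 * a) := by positivity
    have hl0 : 0 ≤ Real.log (1 + 1 / (3 * a)) := Real.log_nonneg (by linarith)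
    refine ⟨1, Real.log (1 + 1 / (3 * a)) / Real.log 3, by positivity, ?_, ?_⟩
    · have hl : Real.log (1 + 1 / (3 * a)) ≤ 1 / (3 * a) := by
        have := Real.log_le_sub_one_of_pos (x := 1 + 1 / (3 * (a:ℝ))) (by positivity)
        linarith
      calc _ ≤ Real.log (1 + 1 / (3 * a)) := div_le_self hl0 h31
        _ ≤ 1 / (3 * a) := hl
        _ ≤ _ := by gcongr; linarith
    · rw [hc, Real.log_mul (by positivity) (by positivity), Real.log_mul (by positivity) ha'.ne',
        Real.log_div (by norm_num) (by norm_num)]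
      field_simp
      push_cast
      ring
  · refine ⟨0, 0, le_rfl, by positivity, ?_⟩
    have hc : ((a / 2 : ℕ) : ℝ) = a / 2 := by
      have : 2 * (a / 2) = a := by omega
      have h' : (2:ℝ) * ((a / 2 : ℕ) : ℝ) = a := by exact_mod_cast this
      linarith
    rw [hc, Real.log_div ha'.ne' (by norm_num)]
    field_simp
    push_cast
    ring

/-- If a Collatz orbit tends to infinity, every positive integer `ψ` occurs infinitely often
as the leading base-3 digit string of the terms of the orbit. -/
theorem unbounded_orbit_leading_digits (a : ℕ → ℕ) (ha0 : 1 ≤ a 0)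
    (hrec : ∀ α : ℕ, a (α + 1) = col2 (a α))
    (hinf : Filter.Tendsto a Filter.atTop Filter.atTop)
    (ψ : ℕ) (hψ : 1 ≤ ψ) :
    {α : ℕ | ⌊(3 : ℝ) ^ (⌊Real.log ψ / Real.log 3⌋ - qseq a α) * (a α)⌋ = (ψ : ℤ)}.Infinite := by
  have h3 : 0 < Real.log 3 := Real.log_pos (by norm_num)
  have hpos : ∀ n, 1 ≤ a n := by
    intro n
    induction n with
    | zero => exact ha0
    | succ n ih => rw [hrec]; unfold col2; split_ifs <;> omega
  choose k e he0 he1 he using fun n => aux_step (a n) (hpos n)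
  have het : Tendsto e atTop (𝓝 0) := by
    refine squeeze_zero he0 he1 ?_
    exact tendsto_one_div_atTop_nhds_zero_nat.comp hinf
  set θ := Real.log 2 / Real.log 3 with hθ
  have hdense : DenseRange (fun n : ℕ => n • ((-θ : ℝ) : AddCircle (1:ℝ))) := by
    rw [← denseRange_zsmul_iff_nsmul, AddCircle.denseRange_zsmul_coe_iff]
    simpa using aux_irr.neg
  have hx : Tendsto (fun n => ((Real.log (a (n+1)) / Real.log 3 : ℝ) : AddCircle (1:ℝ))
      - ((Real.log (a n) / Real.log 3 : ℝ) : AddCircle (1:ℝ))) atTop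
      (𝓝 ((-θ : ℝ) : AddCircle (1:ℝ))) := by
    have h1 : Tendsto (fun n => ((-θ + e n : ℝ) : AddCircle (1:ℝ))) atTop
        (𝓝 ((-θ : ℝ) : AddCircle (1:ℝ))) := by
      have h2 : Tendsto (fun n => -θ + e n) atTop (𝓝 (-θ)) := by
        simpa using het.const_add (-θ)
      exact ((AddCircle.continuous_mk' (1:ℝ)).tendsto (-θ)).comp h2
    refine h1.congr fun n => ?_
    rw [← AddCircle.coe_sub, hrec, he, AddCircle.coe_add (p := (1:ℝ)) (k n : ℝ)]
    have : (((k n : ℤ) : ℝ) : AddCircle (1:ℝ)) = 0 := by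
      rw [AddCircle.coe_eq_zero_iff]; exact ⟨k n, by simp⟩
    rw [this, zero_add]
  set l := Real.log ψ / Real.log 3 with hl
  set r := Real.log (ψ + 1) / Real.log 3 with hr
  have hψ' : (0:ℝ) < ψ := by exact_mod_cast hψ
  have hlr : l < r := by
    rw [hl, hr]
    gcongr
    linarith
  have hlpow : (3:ℝ) ^ l = ψ := by
    rw [Real.rpow_def_of_pos (by norm_num), hl, mul_div_cancel₀ _ h3.ne', Real.exp_log hψ']
  have hrpow : (3:ℝ) ^ r = ψ + 1 := by
    rw [Real.rpow_def_of_pos (by norm_num), hr, mul_div_cancel₀ _ h3.ne', Real.exp_log (by positivity)]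
  have hp0 : 0 ≤ ⌊l⌋ := Int.floor_nonneg.2 (div_nonneg (Real.log_natCast_nonneg _) h3.le)
  have hrle : r ≤ ⌊l⌋ + 1 := by
    obtain ⟨p, hp⟩ := Int.eq_ofNat_of_zero_le hp0
    have hlt : l < (p + 1 : ℕ) := by
      have := Int.lt_floor_add_one l
      rw [hp] at this
      exact_mod_cast this
    have h4 : (3:ℝ) ^ l < 3 ^ ((p + 1 : ℕ) : ℝ) := Real.rpow_lt_rpow_of_exponent_lt (by norm_num) hlt
    rw [hlpow, Real.rpow_natCast] at h4
    have h5 : ψ < 3 ^ (p+1) := by exact_mod_cast h4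
    have h6 : (ψ : ℝ) + 1 ≤ 3 ^ (p+1) := by exact_mod_cast h5
    rw [← hrpow, ← Real.rpow_natCast, Real.rpow_le_rpow_left_iff (by norm_num)] at h6
    rw [hp]; exact_mod_cast h6
  have hopen : IsOpen ((fun z : ℝ => (z : AddCircle (1:ℝ))) '' Set.Ioo l r) :=
    QuotientAddGroup.isOpenMap_coe _ isOpen_Ioo
  have hfreq := aux_rot _ hdense
    (fun n => ((Real.log (a n) / Real.log 3 : ℝ) : AddCircle (1:ℝ))) hx _ hopen
    ((Set.nonempty_Ioo.2 hlr).image _)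
  rw [Nat.frequently_atTop_iff_infinite] at hfreq
  refine hfreq.mono ?_
  rintro n ⟨z, ⟨hz1, hz2⟩, hz⟩
  have hz' : ((Real.log (a n) / Real.log 3 - z : ℝ) : AddCircle (1:ℝ)) = 0 := by
    rw [AddCircle.coe_sub, sub_eq_zero]; exact hz.symm
  rw [AddCircle.coe_eq_zero_iff] at hz'
  obtain ⟨m, hm⟩ := hz'
  simp only [zsmul_eq_mul, mul_one] at hm
  have hap : (0:ℝ) < a n := by exact_mod_cast hpos n
  have hu : Real.log (a n) / Real.log 3 = z + m := by linarith
  have hq : qseq a n = ⌊l⌋ + m := by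
    unfold qseq
    rw [hu, Int.floor_add_intCast, add_left_inj, Int.floor_eq_iff]
    exact ⟨(Int.floor_le l).trans hz1.le, hz2.trans_le hrle⟩
  have han : (a n : ℝ) = 3 ^ (z + m) := by
    rw [← hu, Real.rpow_def_of_pos (by norm_num), mul_div_cancel₀ _ h3.ne', Real.exp_log hap]
  have hval : (3:ℝ) ^ (⌊l⌋ - qseq a n) * (a n) = 3 ^ z := by
    rw [hq, han, ← Real.rpow_intCast, ← Real.rpow_add (by norm_num)]
    congr 1
    push_cast
    ring
  show ⌊(3:ℝ) ^ (⌊l⌋ - qseq a n) * (a n)⌋ = (ψ : ℤ)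
  rw [hval, Int.floor_eq_iff]
  constructor
  · push_cast
    rw [← hlpow]
    exact Real.rpow_le_rpow_of_exponent_le (by norm_num) hz1.le
  · push_cast
    rw [← hrpow]
    exact Real.rpow_lt_rpow_of_exponent_lt (by norm_num) hz2
end

section
/- For every n ∈ ℕ and every b ∈ 𝐍 ∩ [1,3), one has Col₄ⁿ(b) = 3^k · Col₃ⁿ(b), where k = -⌊log(Col₃ⁿ(b)) / log 3⌋. -/
open scoped Classical

/-- `𝐍 = ⋃_{r≥0} 3^{-r}·ℕ`, the nonnegative rationals whose denominator is a power of 3,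
viewed inside `ℝ`. -/
def NN : Set ℝ := {b | ∃ r m : ℕ, b = (m : ℝ) / 3 ^ r}

/-- `q(b) = min {r ≥ 0 : 3^r·b ∈ ℕ}` (for `b ∈ 𝐍`). -/
noncomputable def qexp (b : ℝ) : ℕ := sInf {r : ℕ | ∃ m : ℕ, b = (m : ℝ) / 3 ^ r}

/-- `Col₃(b) = b/2` if `b/2 ∈ 𝐍`, and `(b + 3^{-q(b)-1})/2` otherwise. -/
noncomputable def col3 (b : ℝ) : ℝ :=
  if b / 2 ∈ NN then b / 2 else (b + (3 : ℝ) ^ (-(qexp b : ℤ) - 1)) / 2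

/-- `Col₄(b) = Col₃(b)` if `2 ≤ b < 3`, and `3·Col₃(b)` if `1 ≤ b < 2`. -/
noncomputable def col4 (b : ℝ) : ℝ := if 2 ≤ b then col3 b else 3 * col3 b

theorem NN_div3 {y : ℝ} (k : ℕ) (h : y ∈ NN) : y / 3 ^ k ∈ NN := by
  obtain ⟨r, m, rfl⟩ := h
  exact ⟨r + k, m, by rw [pow_add, div_div]⟩

theorem NN_mul3 {y : ℝ} (k : ℕ) (h : y ∈ NN) : y * 3 ^ k ∈ NN := by
  obtain ⟨r, m, rfl⟩ := h
  exact ⟨r, m * 3 ^ k, by push_cast; ring⟩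

theorem qexp_spec {y : ℝ} (h : y ∈ NN) : ∃ m : ℕ, y = (m : ℝ) / 3 ^ qexp y :=
  Nat.sInf_mem (s := {r : ℕ | ∃ m : ℕ, y = (m : ℝ) / 3 ^ r}) h

theorem qexp_le {y : ℝ} {r m : ℕ} (h : y = (m : ℝ) / 3 ^ r) : qexp y ≤ r :=
  Nat.sInf_le (s := {r : ℕ | ∃ m : ℕ, y = (m : ℝ) / 3 ^ r}) ⟨m, h⟩

theorem qexp_div {y : ℝ} (k : ℕ) (h : y ∈ NN) (h1 : 1 ≤ y) (h3 : y < 3) :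
    qexp (y / 3 ^ k) = qexp y + k := by
  apply le_antisymm
  · obtain ⟨m, hm⟩ := qexp_spec h
    apply qexp_le (m := m)
    rw [pow_add, ← div_div, ← hm]
  · obtain ⟨m, hm⟩ := qexp_spec (NN_div3 k h)
    generalize qexp (y / 3 ^ k) = r at hm
    rw [div_eq_div_iff (by positivity) (by positivity)] at hm
    have hm1 : 1 ≤ m := by
      rcases Nat.eq_zero_or_pos m with h0 | h0
      · subst h0
        have : (0:ℝ) < y * 3 ^ r := by positivity
        rw [hm] at this
        simp at this
      · exact h0
    have hm1' : (1:ℝ) ≤ m := by exact_mod_cast hm1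
    have hk : k ≤ r := by
      have h4 : (3:ℝ) ^ k < 3 ^ (r + 1) := by
        have e1 : (3:ℝ) ^ k ≤ m * 3 ^ k := le_mul_of_one_le_left (by positivity) hm1'
        have e2 : y * 3 ^ r < 3 * 3 ^ r := by gcongr
        rw [pow_succ]; linarith
      have := (pow_lt_pow_iff_right₀ (by norm_num : (1:ℝ) < 3)).1 h4
      omega
    obtain ⟨d, rfl⟩ := Nat.exists_eq_add_of_le hk
    have : qexp y ≤ d := by
      apply qexp_le (m := m)
      rw [eq_div_iff (by positivity)]
      rw [pow_add] at hm
      have : (3:ℝ) ^ k ≠ 0 := by positivity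
      apply mul_right_cancel₀ this
      linarith
    omega

theorem col3_div {y : ℝ} (k : ℕ) (h : y ∈ NN) (h1 : 1 ≤ y) (h3 : y < 3) :
    col3 (y / 3 ^ k) = col3 y / 3 ^ k := by
  have hk : (3:ℝ) ^ k ≠ 0 := by positivity
  have hiff : y / 3 ^ k / 2 ∈ NN ↔ y / 2 ∈ NN := by
    constructor
    · intro hh
      have := NN_mul3 k hh
      convert this using 1
      field_simp
    · intro hh
      have := NN_div3 k hh
      convert this using 1
      ring
  unfold col3
  rw [qexp_div k h h1 h3]
  by_cases hc : y / 2 ∈ NN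
  · rw [if_pos hc, if_pos (hiff.2 hc)]; ring
  · rw [if_neg hc, if_neg (fun hh => hc (hiff.1 hh))]
    have : (3:ℝ) ^ (-((qexp y + k : ℕ) : ℤ) - 1) = 3 ^ (-(qexp y : ℤ) - 1) / 3 ^ k := by
      rw [← zpow_natCast, ← zpow_sub₀ (by norm_num)]
      congr 1
      push_cast; ring
    rw [this]; ring

theorem col3_props {y : ℝ} (h : y ∈ NN) :
    col3 y ∈ NN ∧ y ≤ 2 * col3 y ∧ 2 * col3 y ≤ y + 1 / 3 ∧ (y < 2 → col3 y < 1) := by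
  unfold col3
  split_ifs with hc
  · exact ⟨hc, by linarith, by linarith, fun _ => by linarith⟩
  · obtain ⟨m, hm⟩ := qexp_spec h
    generalize qexp y = q at hm
    have hq : (3:ℝ) ^ (-(q : ℤ) - 1) = 1 / 3 ^ q / 3 := by
      rw [zpow_sub₀ (by norm_num), zpow_neg, zpow_natCast]; norm_num
    rw [hq]
    have hp : (1:ℝ) ≤ 3 ^ q := one_le_pow₀ (by norm_num)
    have hp' : (1:ℝ) / 3 ^ q ≤ 1 := by rw [div_le_one (by positivity)]; exact hp
    have hp0 : (0:ℝ) < 1 / 3 ^ q := by positivity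
    refine ⟨?_, by linarith, by linarith, ?_⟩
    · rcases Nat.even_or_odd' m with ⟨c, rfl | rfl⟩
      · exact absurd ⟨q, c, by rw [hm]; push_cast; ring⟩ hc
      · refine ⟨q + 1, 3 * c + 2, ?_⟩
        rw [hm]; push_cast; field_simp; ring
    · intro hy
      have h5 : (m:ℝ) < 2 * 3 ^ q := by
        rw [hm, div_lt_iff₀ (by positivity)] at hy; exact hy
      have h6 : m + 1 ≤ 2 * 3 ^ q := by exact_mod_cast h5
      have h7 : (m:ℝ) + 1 ≤ 2 * 3 ^ q := by exact_mod_cast h6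
      have h8 : y + 1 / 3 ^ q ≤ 2 := by
        rw [hm, ← add_div, div_le_iff₀ (by positivity)]; exact h7
      linarith

theorem col_inv (n : ℕ) (b : ℝ) (hb : b ∈ NN) (hb1 : 1 ≤ b) (hb3 : b < 3) :
    col4^[n] b ∈ NN ∧ 1 ≤ col4^[n] b ∧ col4^[n] b < 3 ∧
      ∃ k : ℕ, col3^[n] b = col4^[n] b / 3 ^ k := by
  induction n with
  | zero => exact ⟨hb, hb1, hb3, 0, by simp⟩
  | succ n ih =>
    rw [Function.iterate_succ_apply', Function.iterate_succ_apply']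
    obtain ⟨h, h1, h3, k, hk⟩ := ih
    rw [hk]
    generalize col4^[n] b = y at *
    rw [col3_div k h h1 h3]
    obtain ⟨p1, p2, p3, p4⟩ := col3_props h
    unfold col4
    split_ifs with hc
    · exact ⟨p1, by linarith, by linarith, k, rfl⟩
    · have := p4 (not_le.1 hc)
      refine ⟨?_, by linarith, by linarith, k + 1, ?_⟩
      · have := NN_mul3 1 p1
        rwa [pow_one, mul_comm] at this
      · rw [pow_succ]; field_simp

/-- For `b ∈ 𝐍 ∩ [1,3)` and every `n`, `Col₄ⁿ(b) = 3^k · Col₃ⁿ(b)` with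
`k = -⌊log (Col₃ⁿ b) / log 3⌋`. -/
theorem col4_iterate_eq_zpow_mul_col3_iterate (n : ℕ) (b : ℝ)
    (hb : b ∈ NN) (hb1 : 1 ≤ b) (hb3 : b < 3) :
    col4^[n] b = (3 : ℝ) ^ (-⌊Real.log (col3^[n] b) / Real.log 3⌋) * col3^[n] b := by
  obtain ⟨-, h1, h3, k, hk⟩ := col_inv n b hb hb1 hb3
  rw [hk]
  generalize col4^[n] b = y at *
  have hl : 0 < Real.log 3 := Real.log_pos (by norm_num)
  have hf : ⌊Real.log (y / 3 ^ k) / Real.log 3⌋ = -(k : ℤ) := by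
    rw [Real.log_div (by positivity) (by positivity), Real.log_pow, sub_div,
      mul_div_cancel_right₀ _ hl.ne', Int.floor_eq_iff]
    have a1 : 0 ≤ Real.log y / Real.log 3 := div_nonneg (Real.log_nonneg h1) hl.le
    have a2 : Real.log y / Real.log 3 < 1 := by
      rw [div_lt_one hl]; exact Real.log_lt_log (by positivity) h3
    push_cast
    constructor <;> linarith
  rw [hf, neg_neg, zpow_natCast]
  field_simp
end

section
/- Fix a positive integer ξ and n ∈ ℕ. For b ∈ Φ_ξ define k₁ = -⌊log(Col₃ⁿ(b)) / log 3⌋ and k₂ = -⌊log b / log 3 - n·log 2 / log 3⌋. Then, whenever k₁ ≤ q₀ or k₂ ≤ q₀, one has k₁ = k₂, and this common value k depends only on n (not on the choice of b ∈ Φ_ξ); moreover for this k, Col₄ⁿ(b) = 3^k·Col₃ⁿ(b) for every b ∈ Φ_ξ. -/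
open scoped Classical

/-- `q₀ = ⌊log ξ / log 3⌋`. -/
noncomputable def qzero (ξ : ℕ) : ℤ := ⌊Real.log ξ / Real.log 3⌋

/-- `Φ_ξ = { b ∈ 𝐍 \ ⋃_{r=0}^{q₀} 3^{-r}ℕ : ⌊3^{q₀}·b⌋ = ξ }`. -/
noncomputable def Phi (ξ : ℕ) : Set ℝ :=
  {b | b ∈ NN ∧ (∀ r : ℕ, (r : ℤ) ≤ qzero ξ → ¬ ∃ m : ℕ, b = (m : ℝ) / 3 ^ r) ∧
    ⌊(3 : ℝ) ^ (qzero ξ) * b⌋ = (ξ : ℤ)}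

def ThreeRep (q : ℕ) (x : ℝ) : Prop := ∃ m : ℕ, ¬ 3 ∣ m ∧ x = (m : ℝ) / 3 ^ q

lemma ThreeRep.qexp_eq {q m : ℕ} (hm : ¬ 3 ∣ m) : qexp ((m : ℝ) / 3 ^ q) = q := by
  unfold qexp
  apply le_antisymm
  · exact Nat.sInf_le ⟨m, rfl⟩
  · refine le_csInf (s := {r : ℕ | ∃ m' : ℕ, (m : ℝ) / 3 ^ q = (m' : ℝ) / 3 ^ r}) ⟨q, m, rfl⟩ ?_
    rintro r ⟨m', h⟩
    by_contra hlt
    push Not at hlt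
    apply hm
    rw [div_eq_div_iff (by positivity) (by positivity)] at h
    have h2 : m * 3 ^ r = m' * 3 ^ q := by exact_mod_cast h
    obtain ⟨d, rfl⟩ := Nat.exists_eq_add_of_lt hlt
    have h3 : m * 3 ^ r = (3 * (m' * 3 ^ d)) * 3 ^ r := by rw [h2]; ring
    exact ⟨_, Nat.eq_of_mul_eq_mul_right (by positivity) h3⟩

lemma half_mem {q m : ℕ} : ((m : ℝ) / 3 ^ q) / 2 ∈ NN ↔ 2 ∣ m := by
  constructor
  · rintro ⟨r, m', h⟩
    rw [div_div, div_eq_div_iff (by positivity) (by positivity)] at h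
    have h2 : m * 3 ^ r = m' * (3 ^ q * 2) := by exact_mod_cast h
    have h3 : 2 ∣ m * 3 ^ r := by rw [h2]; exact ⟨m' * 3 ^ q, by ring⟩
    exact (Nat.Coprime.pow_right r (by norm_num : Nat.Coprime 2 3)).dvd_of_dvd_mul_right h3
  · rintro ⟨t, rfl⟩
    exact ⟨q, t, by push_cast; ring⟩

lemma col3_even {q t : ℕ} : col3 (((2 * t : ℕ) : ℝ) / 3 ^ q) = (t : ℝ) / 3 ^ q := by
  unfold col3
  rw [if_pos (half_mem.2 ⟨t, rfl⟩)]
  push_cast; ring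

lemma col3_odd {q t : ℕ} (hm : ¬ 3 ∣ (2 * t + 1)) :
    col3 (((2 * t + 1 : ℕ) : ℝ) / 3 ^ q) = ((3 * t + 2 : ℕ) : ℝ) / 3 ^ (q + 1) := by
  unfold col3
  rw [if_neg (by rw [half_mem]; omega), ThreeRep.qexp_eq hm]
  have : (3 : ℝ) ^ (-(q : ℤ) - 1) = 1 / 3 ^ (q + 1) := by
    rw [show (-(q : ℤ) - 1) = -((q + 1 : ℕ) : ℤ) by push_cast; ring, zpow_neg, zpow_natCast,
      one_div]
  rw [this]
  push_cast
  field_simp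
  ring

lemma ThreeRep.col3 {q : ℕ} {x : ℝ} (h : ThreeRep q x) : ∃ q', q ≤ q' ∧ ThreeRep q' (col3 x) := by
  obtain ⟨m, hm, rfl⟩ := h
  obtain ⟨t, rfl | rfl⟩ := Nat.even_or_odd' m
  · exact ⟨q, le_rfl, t, by omega, col3_even⟩
  · exact ⟨q + 1, by omega, 3 * t + 2, by omega, col3_odd hm⟩

lemma scale_eq {q k m : ℕ} (hk : k ≤ q) :
    (3 : ℝ) ^ k * ((m : ℝ) / 3 ^ q) = (m : ℝ) / 3 ^ (q - k) := by
  obtain ⟨d, rfl⟩ := Nat.exists_eq_add_of_le hk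
  rw [Nat.add_sub_cancel_left, pow_add]
  field_simp

lemma ThreeRep.scale {q k : ℕ} {x : ℝ} (h : ThreeRep q x) (hk : k ≤ q) : ThreeRep (q - k) (3 ^ k * x) := by
  obtain ⟨m, hm, rfl⟩ := h
  exact ⟨m, hm, scale_eq hk⟩

lemma ThreeRep.col3_scale {q k : ℕ} {x : ℝ} (h : ThreeRep q x) (hk : k ≤ q) :
    _root_.col3 (3 ^ k * x) = 3 ^ k * _root_.col3 x := by
  obtain ⟨m, hm, rfl⟩ := h
  rw [scale_eq hk]
  obtain ⟨t, rfl | rfl⟩ := Nat.even_or_odd' m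
  · rw [col3_even, col3_even, scale_eq hk]
  · rw [col3_odd hm, col3_odd hm, scale_eq (by omega), Nat.sub_add_comm hk]

lemma ThreeRep.pos {q : ℕ} {x : ℝ} (h : ThreeRep q x) : 0 < x := by
  obtain ⟨m, hm, rfl⟩ := h
  have : 0 < m := by rcases Nat.eq_zero_or_pos m with rfl | h <;> simp_all
  positivity

lemma ThreeRep.col3_ge {q : ℕ} {x : ℝ} (h : ThreeRep q x) : x / 2 ≤ _root_.col3 x := by
  unfold _root_.col3
  split_ifs
  · rfl
  · have : (0 : ℝ) < 3 ^ (-(qexp x : ℤ) - 1) := by positivity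
    linarith

lemma ThreeRep.col3_lt {q : ℕ} {x : ℝ} (h : ThreeRep q x) {M : ℕ} (hx : x < 2 * M) :
    _root_.col3 x < M := by
  obtain ⟨m, hm, rfl⟩ := h
  rw [div_lt_iff₀ (by positivity)] at hx
  have hx' : m < 2 * M * 3 ^ q := by exact_mod_cast hx
  obtain ⟨t, rfl | rfl⟩ := Nat.even_or_odd' m
  · rw [col3_even, div_lt_iff₀ (by positivity)]
    have : t < M * 3 ^ q := by rw [mul_assoc] at hx'; omega
    exact_mod_cast this
  · rw [col3_odd hm, div_lt_iff₀ (by positivity)]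
    have : 3 * t + 2 < M * 3 ^ (q + 1) := by rw [pow_succ, ← mul_assoc]; rw [mul_assoc] at hx'; omega
    exact_mod_cast this

lemma ThreeRep.iter {q : ℕ} {x : ℝ} (h : ThreeRep q x) (n : ℕ) : ∃ q', q ≤ q' ∧ ThreeRep q' (_root_.col3^[n] x) := by
  induction n with
  | zero => exact ⟨q, le_rfl, h⟩
  | succ n ih =>
    obtain ⟨q', h1, h2⟩ := ih
    obtain ⟨q'', h3, h4⟩ := h2.col3
    rw [Function.iterate_succ_apply']
    exact ⟨q'', h1.trans h3, h4⟩

lemma ThreeRep.iter_ge {q : ℕ} {x : ℝ} (h : ThreeRep q x) (n : ℕ) : x / 2 ^ n ≤ _root_.col3^[n] x := by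
  induction n with
  | zero => simp
  | succ n ih =>
    obtain ⟨q', h1, h2⟩ := h.iter n
    rw [Function.iterate_succ_apply']
    refine le_trans ?_ h2.col3_ge
    rw [pow_succ, ← div_div]
    linarith

lemma ThreeRep.iter_lt {q r : ℕ} {M : ℕ} (hr : r ≤ q) (n : ℕ) : ∀ {q : ℕ} {x : ℝ}, r ≤ q → ThreeRep q x →
    3 ^ r * x < 2 ^ n * M → 3 ^ r * _root_.col3^[n] x < M := by
  induction n with
  | zero => intro q x _ _ h; simpa using h
  | succ n ih =>
    intro q x hq h hx
    rw [Function.iterate_succ_apply]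
    obtain ⟨q', h1, h2⟩ := h.col3
    refine ih (hq.trans h1) h2 ?_
    rw [← h.col3_scale hq]
    have := (h.scale hq).col3_lt (M := 2 ^ n * M) (by push_cast; rw [pow_succ] at hx; linarith)
    exact_mod_cast this

lemma ThreeRep.iter_lt_three {q : ℕ} {x : ℝ} (h : ThreeRep q x) (hx : x < 3) (n : ℕ) :
    _root_.col3^[n] x < 3 := by
  have := ThreeRep.iter_lt (r := 0) (M := 3) (Nat.zero_le q) n (Nat.zero_le q) h (by
    have : (1 : ℝ) ≤ 2 ^ n := one_le_pow₀ (by norm_num)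
    push_cast
    nlinarith)
  simpa using this

lemma ThreeRep.col4_iter {q : ℕ} {b : ℝ} (h : ThreeRep q b) (hb1 : 1 ≤ b) (hb : b < 3) (n : ℕ) :
    ∀ k ≤ q, 1 ≤ 3 ^ k * _root_.col3^[n] b → 3 ^ k * _root_.col3^[n] b < 3 →
      col4^[n] b = 3 ^ k * _root_.col3^[n] b := by
  induction n with
  | zero =>
    intro k hk h1 h2
    simp only [Function.iterate_zero, id] at *
    have : k = 0 := by
      by_contra hk0
      have : (3 : ℝ) ^ 1 ≤ 3 ^ k := pow_le_pow_right₀ (by norm_num) (by omega)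
      nlinarith
    subst this; simp
  | succ n ih =>
    intro k hk h1 h2
    obtain ⟨q', hq', hR⟩ := h.iter n
    have hlt3 := h.iter_lt_three hb n
    rw [Function.iterate_succ_apply'] at h1 h2 ⊢
    rw [Function.iterate_succ_apply']
    set x := _root_.col3^[n] b with hx
    have hkq : k ≤ q' := hk.trans hq'
    have hc2 : 2 ≤ 3 ^ k * x := by
      by_contra hc
      push Not at hc
      have := (hR.scale hkq).col3_lt (M := 1) (by push_cast; linarith)
      rw [hR.col3_scale hkq] at this
      push_cast at this
      linarith
    by_cases hc3 : 3 ^ k * x < 3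
    · rw [ih k hk (by linarith) hc3]
      unfold col4
      rw [if_pos hc2, hR.col3_scale hkq]
    · push Not at hc3
      rcases k with _ | k
      · simp at hc3; linarith
      have hge := hR.col3_ge
      have e : (3 : ℝ) ^ (k + 1) * _root_.col3 x = 3 * (3 ^ k * _root_.col3 x) := by ring
      have e2 : (3 : ℝ) ^ (k + 1) * x = 3 * (3 ^ k * x) := by ring
      rw [e] at h2 ⊢
      rw [e2] at hc3
      have hp : (0 : ℝ) < 3 ^ k := by positivity
      have h5 : 3 ^ k * (x / 2) ≤ 3 ^ k * _root_.col3 x := by gcongr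
      have h6 : 3 ^ k * x < 2 := by linarith
      rw [ih k (by omega) (by linarith) (by linarith)]
      unfold col4
      rw [if_neg (by linarith), hR.col3_scale (by omega)]

lemma floor_le_iff {y : ℝ} (hy : 0 < y) (k : ℤ) :
    -⌊Real.log y / Real.log 3⌋ ≤ k ↔ 1 ≤ 3 ^ k * y := by
  have h3 : 0 < Real.log 3 := Real.log_pos (by norm_num)
  rw [neg_le, Int.le_floor, le_div_iff₀ h3, ← Real.log_nonneg_iff (by positivity),
    Real.log_mul (by positivity) hy.ne', Real.log_zpow]
  push_cast
  constructor <;> intro h <;> linarith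

lemma qzero_spec {ξ : ℕ} (hξ : 1 ≤ ξ) : ∃ Q : ℕ, qzero ξ = Q ∧ 3 ^ Q ≤ ξ ∧ ξ < 3 ^ (Q + 1) := by
  have hp : (0 : ℝ) < ξ := by exact_mod_cast hξ
  have key := floor_le_iff hp
  have h0 : 0 ≤ qzero ξ := by
    have := (key 0).2 (by simpa using hξ)
    unfold qzero; omega
  obtain ⟨Q, hQ⟩ := Int.eq_ofNat_of_zero_le h0
  unfold qzero at hQ ⊢
  refine ⟨Q, hQ, ?_, ?_⟩
  · have := (key (-(Q : ℤ))).1 (by omega)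
    rw [zpow_neg, zpow_natCast, ← div_eq_inv_mul, le_div_iff₀ (by positivity), one_mul] at this
    exact_mod_cast this
  · have := mt (key (-((Q + 1 : ℕ) : ℤ))).2 (by push_cast; omega)
    rw [zpow_neg, zpow_natCast, ← div_eq_inv_mul, le_div_iff₀ (by positivity), one_mul] at this
    push Not at this
    exact_mod_cast this

lemma Phi_spec {ξ Q : ℕ} (hQ : qzero ξ = Q) {b : ℝ} (hb : b ∈ Phi ξ) :
    (∃ q, Q ≤ q ∧ ThreeRep q b) ∧ (ξ : ℝ) ≤ 3 ^ Q * b ∧ 3 ^ Q * b < ξ + 1 := by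
  obtain ⟨⟨r, m, h⟩, h2, h3⟩ := hb
  constructor
  · have hne : ∃ r : ℕ, ∃ m : ℕ, b = (m : ℝ) / 3 ^ r := ⟨r, m, h⟩
    obtain ⟨m, hm⟩ := Nat.find_spec hne
    set q := Nat.find hne with hq
    have hQq : Q < q := by
      by_contra hc
      exact h2 q (by rw [hQ]; omega) ⟨m, hm⟩
    refine ⟨q, hQq.le, m, ?_, hm⟩
    rintro ⟨t, rfl⟩
    have : ¬ _ := Nat.find_min hne (m := q - 1) (by omega)
    apply this
    refine ⟨t, ?_⟩
    rw [hm]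
    obtain ⟨p, hp⟩ : ∃ p, q = p + 1 := ⟨q - 1, by omega⟩
    rw [hp, Nat.add_sub_cancel, pow_succ]
    push_cast
    field_simp
  · rw [hQ, zpow_natCast, Int.floor_eq_iff] at h3
    exact_mod_cast h3

/-- For `b ∈ Φ_ξ`, whenever `k₁ = -⌊log (Col₃ⁿ b)/log 3⌋ ≤ q₀` or
`k₂ = -⌊log b/log 3 - n·log 2/log 3⌋ ≤ q₀`, one has `k₁ = k₂`; the common value `k` depends
only on `n`, and `Col₄ⁿ(b) = 3^k·Col₃ⁿ(b)` for every `b ∈ Φ_ξ`. -/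
theorem phi_common_exponent (ξ : ℕ) (hξ : 1 ≤ ξ) (n : ℕ) :
    ∃ k : ℤ, ∀ b ∈ Phi ξ,
      (-⌊Real.log (col3^[n] b) / Real.log 3⌋ ≤ qzero ξ ∨
        -⌊Real.log b / Real.log 3 - (n : ℝ) * Real.log 2 / Real.log 3⌋ ≤ qzero ξ) →
      (-⌊Real.log (col3^[n] b) / Real.log 3⌋ =
          -⌊Real.log b / Real.log 3 - (n : ℝ) * Real.log 2 / Real.log 3⌋ ∧
        -⌊Real.log (col3^[n] b) / Real.log 3⌋ = k ∧
        col4^[n] b = (3 : ℝ) ^ k * col3^[n] b) := by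
  obtain ⟨Q, hQ, hQ1, hQ2⟩ := qzero_spec hξ
  have hQ1' : (3 : ℝ) ^ Q ≤ ξ := by exact_mod_cast hQ1
  have hQ2' : (ξ : ℝ) + 1 ≤ 3 ^ Q * 3 := by rw [← pow_succ]; exact_mod_cast hQ2
  have hQp : (0 : ℝ) < 3 ^ Q := by positivity
  -- key characterization
  have key : ∀ b ∈ Phi ξ, ∀ k : ℤ, k ≤ Q →
      ((-⌊Real.log b / Real.log 3 - (n : ℝ) * Real.log 2 / Real.log 3⌋ ≤ k ↔
        2 ^ n * 3 ^ (Q - k).toNat ≤ ξ) ∧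
      (-⌊Real.log (col3^[n] b) / Real.log 3⌋ ≤ k ↔ 2 ^ n * 3 ^ (Q - k).toNat ≤ ξ)) := by
    intro b hb k hk
    obtain ⟨⟨q, hq, hR⟩, h1, h2⟩ := Phi_spec hQ hb
    have hbp := hR.pos
    have hb3 : b < 3 := by nlinarith
    obtain ⟨q', -, hR'⟩ := hR.iter n
    have hlog : Real.log b / Real.log 3 - (n : ℝ) * Real.log 2 / Real.log 3 =
        Real.log (b / 2 ^ n) / Real.log 3 := by
      rw [Real.log_div hbp.ne' (by positivity), Real.log_pow]; ring
    rw [hlog, floor_le_iff (by positivity), floor_le_iff hR'.pos]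
    obtain ⟨d, hd⟩ := Int.eq_ofNat_of_zero_le (sub_nonneg.2 hk)
    have hkd : k = Q - d := by omega
    have hz : (3 : ℝ) ^ k * 3 ^ d = 3 ^ Q := by
      rw [← zpow_natCast, ← zpow_natCast, ← zpow_add₀ (by norm_num)]
      congr 1; omega
    have hdp : (0 : ℝ) < 3 ^ d := by positivity
    have h2p : (0 : ℝ) < 2 ^ n := by positivity
    have hkp : (0 : ℝ) < 3 ^ k := by positivity
    rw [hd, Int.toNat_natCast]
    have A : 1 ≤ 3 ^ k * (b / 2 ^ n) ↔ 2 ^ n * 3 ^ d ≤ ξ := by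
      rw [← mul_div_assoc, le_div_iff₀ h2p, one_mul, ← mul_le_mul_iff_left₀ hdp]
      rw [show 3 ^ k * b * 3 ^ d = 3 ^ Q * b by rw [← hz]; ring]
      constructor
      · intro h
        have : ((2 ^ n * 3 ^ d : ℕ) : ℝ) < (ξ + 1 : ℕ) := by push_cast; linarith
        have := Nat.cast_lt.1 this
        omega
      · intro h
        have : ((2 ^ n * 3 ^ d : ℕ) : ℝ) ≤ ξ := by exact_mod_cast h
        push_cast at this
        linarith
    refine ⟨A, ?_⟩
    rw [← A]
    constructor
    · intro h
      by_contra hc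
      push Not at hc
      rcases lt_or_ge k 0 with hk0 | hk0
      · have := hR.iter_lt_three hb3 n
        have h3 : (3 : ℝ) ^ k ≤ 3 ^ (-1 : ℤ) := zpow_le_zpow_right₀ (by norm_num) (by omega)
        have h4 : (3 : ℝ) ^ (-1 : ℤ) = 1 / 3 := by norm_num
        have h5 := mul_le_mul_of_nonneg_right (h3.trans_eq h4) hR'.pos.le
        linarith
      · obtain ⟨j, rfl⟩ := Int.eq_ofNat_of_zero_le hk0
        rw [zpow_natCast] at h hc
        have := ThreeRep.iter_lt (r := j) (M := 1) (q := q) (by omega) n (by omega) hR (by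
          rw [← mul_div_assoc, div_lt_iff₀ h2p] at hc
          push_cast; linarith)
        push_cast at this
        linarith
    · intro h
      exact h.trans (mul_le_mul_of_nonneg_left (hR.iter_ge n) hkp.le)
  rw [hQ]
  have eqs : ∀ b ∈ Phi ξ, (-⌊Real.log (col3^[n] b) / Real.log 3⌋ ≤ (Q : ℤ) ∨
        -⌊Real.log b / Real.log 3 - (n : ℝ) * Real.log 2 / Real.log 3⌋ ≤ (Q : ℤ)) →
      (-⌊Real.log (col3^[n] b) / Real.log 3⌋ ≤ (Q : ℤ) ∧ -⌊Real.log (col3^[n] b) / Real.log 3⌋ =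
          -⌊Real.log b / Real.log 3 - (n : ℝ) * Real.log 2 / Real.log 3⌋) := by
    intro b hb h
    have K := key b hb
    generalize -⌊Real.log (col3^[n] b) / Real.log 3⌋ = k1 at *
    generalize -⌊Real.log b / Real.log 3 - (n : ℝ) * Real.log 2 / Real.log 3⌋ = k2 at *
    have K' : ∀ k : ℤ, k ≤ Q → (k2 ≤ k ↔ k1 ≤ k) := fun k hk => (K k hk).1.trans (K k hk).2.symm
    have h1 : k1 ≤ Q := h.elim id (fun h => (K' _ le_rfl).1 h)
    have h2 : k2 ≤ Q := (K' _ le_rfl).2 h1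
    exact ⟨h1, le_antisymm ((K' _ h2).1 le_rfl) ((K' _ h1).2 le_rfl)⟩
  by_cases hex : ∃ b ∈ Phi ξ, -⌊Real.log (col3^[n] b) / Real.log 3⌋ ≤ (Q : ℤ)
  · obtain ⟨b₀, hb₀, hk₀⟩ := hex
    refine ⟨-⌊Real.log (col3^[n] b₀) / Real.log 3⌋, fun b hb h => ?_⟩
    obtain ⟨h1, h2⟩ := eqs b hb h
    have h3 : -⌊Real.log (col3^[n] b) / Real.log 3⌋ = -⌊Real.log (col3^[n] b₀) / Real.log 3⌋ := by
      apply le_antisymm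
      · exact (key b hb _ hk₀).2.2 ((key b₀ hb₀ _ hk₀).2.1 le_rfl)
      · exact (key b₀ hb₀ _ h1).2.2 ((key b hb _ h1).2.1 le_rfl)
    refine ⟨h2, h3, ?_⟩
    rw [← h3]
    obtain ⟨⟨q, hq, hR⟩, hl, hu⟩ := Phi_spec hQ hb
    have hb3 : b < 3 := by nlinarith
    have hb1 : 1 ≤ b := by nlinarith
    obtain ⟨q', -, hR'⟩ := hR.iter n
    have F := floor_le_iff hR'.pos
    have hlt := hR.iter_lt_three hb3 n
    generalize -⌊Real.log (col3^[n] b) / Real.log 3⌋ = k at *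
    have f1 := (F k).1 le_rfl
    have f2 := mt (F (k - 1)).2 (by omega)
    rw [zpow_sub_one₀ (by norm_num)] at f2
    push Not at f2
    have hk0 : 0 ≤ k := by
      by_contra hc
      have h3 : (3 : ℝ) ^ k ≤ 3 ^ (-1 : ℤ) := zpow_le_zpow_right₀ (by norm_num) (by omega)
      have h4 : (3 : ℝ) ^ (-1 : ℤ) = 1 / 3 := by norm_num
      have h5 := mul_le_mul_of_nonneg_right (h3.trans_eq h4) hR'.pos.le
      linarith
    obtain ⟨j, rfl⟩ := Int.eq_ofNat_of_zero_le hk0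
    rw [zpow_natCast] at f1 f2 ⊢
    exact hR.col4_iter hb1 hb3 n j (by omega) f1 (by linarith)
  · push Not at hex
    refine ⟨0, fun b hb h => ?_⟩
    have := hex b hb
    have := (eqs b hb h).1
    omega
end

section
/- Assume a₀ is a positive integer whose Col₂-orbit a_α tends to infinity. Then the closure of the set { c_α : α ∈ ℕ } in the real line equals the closed interval [1, 3], where c_α = 3^{-q_α}·a_α and q_α = ⌊log a_α / log 3⌋. -/
open Filter Topology in
lemma aux_dense (u : ℕ → AddCircle (1:ℝ)) (t : AddCircle (1:ℝ))
    (ht : DenseRange (fun m : ℕ => m • t))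
    (h : Tendsto (fun n => u (n+1) - u n) atTop (𝓝 t)) : DenseRange u := by
  have : Fact ((0:ℝ) < 1) := ⟨one_pos⟩
  obtain ⟨x, ψ, hψ, hx⟩ := CompactSpace.tendsto_subseq u
  have key : ∀ m : ℕ, Tendsto (fun n => u (ψ n + m)) atTop (𝓝 (x + m • t)) := by
    intro m
    induction m with
    | zero => simpa [Function.comp_def] using hx
    | succ k ih =>
      have h1 : Tendsto (fun n => ψ n + k) atTop atTop :=
        tendsto_atTop_mono (fun n => Nat.le_add_right _ _) hψ.tendsto_atTop
      have h2 := ih.add (h.comp h1)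
      rw [succ_nsmul, ← add_assoc]
      refine h2.congr fun n => ?_
      simp [add_assoc]
  have hd : DenseRange (fun m : ℕ => x + m • t) :=
    (Homeomorph.addLeft x).surjective.denseRange.comp ht (Homeomorph.addLeft x).continuous
  have hsub : Set.range (fun m : ℕ => x + m • t) ⊆ closure (Set.range u) := by
    rintro _ ⟨m, rfl⟩
    exact mem_closure_of_tendsto (key m) (Eventually.of_forall fun n => ⟨_, rfl⟩)
  exact dense_closure.1 (Dense.mono hsub hd)

lemma aux_irr_s12 : Irrational (Real.logb 3 2) := by
  rintro ⟨r, hr⟩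
  have h2 : (0:ℝ) < Real.logb 3 2 := Real.logb_pos (by norm_num) (by norm_num)
  have hrp : 0 < r := by rw [← hr] at h2; exact_mod_cast h2
  have hq : (0:ℝ) < r.den := by exact_mod_cast r.den_pos
  obtain ⟨p, hp⟩ := Int.eq_ofNat_of_zero_le (Rat.num_nonneg.2 hrp.le)
  have hrd : (r:ℝ) * r.den = p := by
    have := Rat.mul_den_eq_num r
    rw [hp] at this
    exact_mod_cast this
  have h3 : (3:ℝ)^p = 2 ^ r.den := by
    have : (2:ℝ) = 3 ^ (r:ℝ) := by
      rw [hr, Real.rpow_logb] <;> norm_num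
    conv_rhs => rw [this]
    rw [← Real.rpow_natCast, ← Real.rpow_natCast, ← Real.rpow_mul (by norm_num), hrd]
  have h4 : 3 ^ p = 2 ^ r.den := by exact_mod_cast h3
  have h5 : Odd (3 ^ p) := Odd.pow (by decide)
  rw [h4] at h5
  exact (Nat.not_odd_iff_even.2 ((Nat.even_pow.2 ⟨even_two, r.den_pos.ne'⟩))) h5

lemma aux_dense_rot : DenseRange (fun m : ℕ => m • ((-Real.logb 3 2 : ℝ) : AddCircle (1:ℝ))) := by
  have : Fact ((0:ℝ) < 1) := ⟨one_pos⟩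
  rw [← denseRange_zsmul_iff_nsmul, AddCircle.denseRange_zsmul_coe_iff, div_one]
  exact aux_irr_s12.neg

lemma aux_cseq (a : ℕ → ℕ) (α : ℕ) (h : 1 ≤ a α) :
    cseq a α = (3:ℝ) ^ (Int.fract (Real.logb 3 (a α))) := by
  have h0 : (0:ℝ) < a α := by exact_mod_cast h
  have : qseq a α = ⌊Real.logb 3 (a α)⌋ := rfl
  rw [cseq, this, Int.fract, sub_eq_add_neg, Real.rpow_add (by norm_num),
    Real.rpow_logb (by norm_num) (by norm_num) h0, mul_comm, ← Int.cast_neg, Real.rpow_intCast]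

lemma aux_step_s12 (n : ℕ) (h : 1 ≤ n) : ∃ ε : ℝ, 0 ≤ ε ∧ ε ≤ Real.logb 3 (1 + (n:ℝ)⁻¹) ∧
    ((Real.logb 3 (col2 n) : ℝ) : AddCircle (1:ℝ)) - (Real.logb 3 n : ℝ) =
      ((-Real.logb 3 2 + ε : ℝ) : AddCircle (1:ℝ)) := by
  have h0 : (0:ℝ) < n := by exact_mod_cast h
  unfold col2
  split_ifs with ho
  · have hc : (((3 * n + 1) / 2 : ℕ) : ℝ) = 3 * n * (1 + (3 * n : ℝ)⁻¹) / 2 := by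
      rw [Nat.cast_div (by omega) (by norm_num)]
      push_cast; field_simp
    refine ⟨Real.logb 3 (1 + (3 * n : ℝ)⁻¹), Real.logb_nonneg (by norm_num) ?_, ?_, ?_⟩
    · have : (0:ℝ) < (3 * n : ℝ)⁻¹ := by positivity
      linarith
    · apply Real.logb_le_logb_of_le (by norm_num) (by positivity)
      gcongr; linarith
    · rw [hc, Real.logb_div (by positivity) (by norm_num), Real.logb_mul (by positivity) (by positivity),
        Real.logb_mul (by positivity) (by positivity), Real.logb_self_eq_one (by norm_num),
        ← AddCircle.coe_sub]
      have : ((1:ℝ) : AddCircle (1:ℝ)) = 0 := AddCircle.coe_period 1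
      rw [← zero_add (((-Real.logb 3 2 + _ : ℝ)) : AddCircle (1:ℝ)), ← this, ← AddCircle.coe_add]
      congr 1; ring
  · refine ⟨0, le_rfl, Real.logb_nonneg (by norm_num) ?_, ?_⟩
    · have : (0:ℝ) < (n : ℝ)⁻¹ := by positivity
      linarith
    · rw [Nat.cast_div (by omega) (by norm_num), Real.logb_div (by positivity) (by norm_num),
        ← AddCircle.coe_sub]
      congr 1; push_cast; ring

/-- If a Collatz orbit tends to infinity, the closure of `{c_α : α ∈ ℕ}` is `[1,3]`. -/
theorem closure_cseq_eq_Icc (a : ℕ → ℕ) (ha0 : 1 ≤ a 0)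
    (hrec : ∀ α : ℕ, a (α + 1) = col2 (a α))
    (hinf : Filter.Tendsto a Filter.atTop Filter.atTop) :
    closure (Set.range (cseq a)) = Set.Icc (1 : ℝ) 3 := by
  have hpos : ∀ α, 1 ≤ a α := by
    intro α
    induction α with
    | zero => exact ha0
    | succ k ih =>
      rw [hrec, col2]
      split_ifs <;> omega
  have hd : DenseRange (fun α => ((Real.logb 3 (a α) : ℝ) : AddCircle (1:ℝ))) := by
    apply aux_dense _ _ aux_dense_rot
    choose ε h1 h2 h3 using fun α => aux_step_s12 (a α) (hpos α)
    have hε : Filter.Tendsto ε Filter.atTop (nhds 0) := by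
      refine squeeze_zero h1 h2 ?_
      have t1 : Filter.Tendsto (fun α => (1:ℝ) + ((a α : ℝ))⁻¹) Filter.atTop (nhds (1 + 0)) :=
        (tendsto_inv_atTop_zero.comp (tendsto_natCast_atTop_atTop.comp hinf)).const_add 1
      rw [add_zero] at t1
      have t2 := (t1.log one_ne_zero).div_const (Real.log 3)
      simpa [Real.logb] using t2
    have t3 : Filter.Tendsto (fun α => -Real.logb 3 2 + ε α) Filter.atTop
        (nhds (-Real.logb 3 2)) := by simpa using hε.const_add (-Real.logb 3 2)
    have t4 := ((AddCircle.continuous_mk' (1:ℝ)).tendsto _).comp t3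
    refine t4.congr fun α => ?_
    rw [hrec α]
    exact (h3 α).symm
  apply Set.Subset.antisymm
  · refine closure_minimal ?_ isClosed_Icc
    rintro _ ⟨α, rfl⟩
    rw [aux_cseq a α (hpos α)]
    constructor
    · exact Real.one_le_rpow (by norm_num) (Int.fract_nonneg _)
    · calc (3:ℝ) ^ (Int.fract (Real.logb 3 (a α))) ≤ 3 ^ (1:ℝ) :=
          Real.rpow_le_rpow_of_exponent_le (by norm_num) (Int.fract_lt_one _).le
        _ = 3 := Real.rpow_one 3
  · rw [← closure_Ioo (by norm_num : (1:ℝ) ≠ 3)]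
    refine closure_minimal ?_ isClosed_closure
    intro y hy
    rw [mem_closure_iff]
    intro V hV hyV
    have hy0 : (0:ℝ) < y := by linarith [hy.1]
    have hcont : Continuous (fun s : ℝ => (3:ℝ) ^ s) := Real.continuous_const_rpow (by norm_num)
    have hU : IsOpen (Set.Ioo (0:ℝ) 1 ∩ (fun s : ℝ => (3:ℝ) ^ s) ⁻¹' V) :=
      isOpen_Ioo.inter (hV.preimage hcont)
    have hU' := QuotientAddGroup.isOpenMap_coe (N := AddSubgroup.zmultiples (1:ℝ)) _ hU
    obtain ⟨α, s, ⟨hs, hsV⟩, hα⟩ := hd.exists_mem_open hU' (by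
      refine ⟨_, Real.logb 3 y, ⟨⟨Real.logb_pos (by norm_num) hy.1, ?_⟩, ?_⟩, rfl⟩
      · rw [Real.logb_lt_iff_lt_rpow (by norm_num) hy0, Real.rpow_one]; exact hy.2
      · show (3:ℝ) ^ (Real.logb 3 y) ∈ V
        rwa [Real.rpow_logb (by norm_num) (by norm_num) hy0])
    refine ⟨_, ?_, α, rfl⟩
    rw [aux_cseq a α (hpos α)]
    obtain ⟨z, hz⟩ := AddSubgroup.mem_zmultiples_iff.1 (QuotientAddGroup.eq.1 hα)
    have : Int.fract (Real.logb 3 (a α)) = s := by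
      rw [Int.fract_eq_iff]
      refine ⟨hs.1.le, hs.2, z, ?_⟩
      simp at hz
      linarith
    rw [this]; exact hsV
end

section
/- For every b ∈ 𝐍, the iterates Col₃ⁿ(b) converge to 0 as n → ∞. -/
open scoped Classical

lemma col3_step (b : ℝ) (hb : b ∈ NN) : col3 b ∈ NN ∧ 0 ≤ col3 b ∧ col3 b ≤ 2 / 3 * b := by
  have hb0 : 0 ≤ b := by
    obtain ⟨r, m, rfl⟩ := hb
    positivity
  unfold col3
  split_ifs with h
  · exact ⟨h, by linarith, by linarith⟩
  · have hne : {r : ℕ | ∃ m : ℕ, b = (m : ℝ) / 3 ^ r}.Nonempty := hb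
    obtain ⟨m, hm⟩ : ∃ m : ℕ, b = (m : ℝ) / 3 ^ (qexp b) := Nat.sInf_mem hne
    generalize qexp b = q at *
    have hz : (3 : ℝ) ^ (-(q : ℤ) - 1) = 1 / 3 ^ (q + 1) := by
      rw [show (-(q : ℤ) - 1) = -((q + 1 : ℕ) : ℤ) by push_cast; ring, zpow_neg, zpow_natCast,
        one_div]
    rw [hz]
    rcases Nat.even_or_odd' m with ⟨k, hk | hk⟩
    · exfalso
      apply h
      refine ⟨q, k, ?_⟩
      rw [hm, hk]
      push_cast
      ring
    · subst hk
      have e : (b + 1 / 3 ^ (q + 1)) / 2 = ((3 * k + 2 : ℕ) : ℝ) / 3 ^ (q + 1) := by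
        rw [hm, pow_succ]
        push_cast
        field_simp
        ring
      rw [e]
      refine ⟨⟨q + 1, _, rfl⟩, by positivity, ?_⟩
      rw [hm]
      have : 2 / 3 * (((2 * k + 1 : ℕ) : ℝ) / 3 ^ q) = ((4 * k + 2 : ℕ) : ℝ) / 3 ^ (q + 1) := by
        rw [pow_succ]
        push_cast
        field_simp
        ring
      rw [this]
      gcongr
      norm_num

/-- For every `b ∈ 𝐍`, the iterates `Col₃ⁿ(b)` tend to `0`. -/
theorem col3_iterate_tendsto_zero (b : ℝ) (hb : b ∈ NN) :
    Filter.Tendsto (fun n => col3^[n] b) Filter.atTop (nhds 0) := by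
  have key : ∀ n, col3^[n] b ∈ NN ∧ 0 ≤ col3^[n] b ∧ col3^[n] b ≤ (2 / 3 : ℝ) ^ n * b := by
    intro n
    induction n with
    | zero =>
      refine ⟨hb, ?_, by simp⟩
      obtain ⟨r, m, rfl⟩ := hb
      simp only [Function.iterate_zero, id]
      positivity
    | succ n ih =>
      rw [Function.iterate_succ_apply']
      obtain ⟨h1, h2, h3⟩ := col3_step _ ih.1
      refine ⟨h1, h2, h3.trans ?_⟩
      rw [pow_succ]
      linarith [ih.2.2]
  have hl : Filter.Tendsto (fun n : ℕ => (2 / 3 : ℝ) ^ n * b) Filter.atTop (nhds 0) := by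
    simpa using (tendsto_pow_atTop_nhds_zero_of_lt_one (r := (2 / 3 : ℝ)) (by norm_num)
      (by norm_num)).mul_const b
  exact squeeze_zero (fun n => (key n).2.1) (fun n => (key n).2.2) hl
end
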